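/- Let n ≥ 3 and let ‖·‖ be a norm on ℝⁿ with ‖x‖ ≤ ‖x‖₂ for all x. Let F ⊆ ℝⁿ be a linear subspace with 1 ≤ dim F ≤ n/2, let T : F → F be an invertible linear map, and suppose that for constants C₀, c₀ > 0 we have P( | ‖TZ‖ − E‖TZ‖ | > ε·E‖TZ‖ ) ≤ C₀ e^{−c₀ ε log n} for all ε > 0, where Z ~ N(0, I_F). Let W ~ N(0, I_{F^⊥}) be independent of Z, set λ = E‖TZ‖ / ( E‖W‖₂ · log n ), and define S : ℝⁿ → ℝⁿ by S(x + y) = Tx + λy for x ∈ F, y ∈ F^⊥. Then: (i) E‖TZ‖ ≤ E‖SG‖ ≤ (1 + 1/log n)·E‖TZ‖, where G ~ N(0, Iₙ); and (ii) there exist constants C, c > 0 depending only on C₀ and c₀ such that P( | ‖SG‖ − E‖SG‖ | > ε·E‖SG‖ ) ≤ C e^{−c ε log n} for all ε ∈ (0, 1). -/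

import Mathlib

open MeasureTheory ProbabilityTheory Real

/-- The standard Gaussian measure `γ_d` on `ℝᵈ`. -/
noncomputable def stdGaussian (d : ℕ) : Measure (Fin d → ℝ) :=
  Measure.pi fun _ => gaussianReal 0 1

/-- The Euclidean norm on `ℝᵈ`. -/
noncomputable def euclNorm {d : ℕ} (x : Fin d → ℝ) : ℝ :=
  Real.sqrt (∑ i, (x i) ^ 2)

/-- The standard inner product on `ℝᵈ`. -/
def dotProd {d : ℕ} (x y : Fin d → ℝ) : ℝ := ∑ i, x i * y i

/-- The first absolute moment of the standard real Gaussian. -/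
noncomputable def gaussianAbsMean : ℝ := ∫ x, |x| ∂gaussianReal 0 1

instance isProbabilityMeasure_stdGaussian (d : ℕ) : IsProbabilityMeasure (stdGaussian d) := by
  unfold _root_.stdGaussian; infer_instance

lemma euclNorm_eq_norm {d : ℕ} (x : Fin d → ℝ) : euclNorm x = ‖WithLp.toLp 2 x‖ := by
  simp [euclNorm, EuclideanSpace.norm_eq]

lemma euclNorm_nonneg {d : ℕ} (x : Fin d → ℝ) : 0 ≤ euclNorm x := Real.sqrt_nonneg _

lemma sq_euclNorm {d : ℕ} (x : Fin d → ℝ) : euclNorm x ^ 2 = ∑ i, x i ^ 2 :=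
  Real.sq_sqrt (Finset.sum_nonneg fun i _ => sq_nonneg (x i))

lemma continuous_euclNorm {d : ℕ} : Continuous (euclNorm : (Fin d → ℝ) → ℝ) := by
  unfold euclNorm; fun_prop

lemma euclNorm_le_sum_abs {d : ℕ} (x : Fin d → ℝ) : euclNorm x ≤ ∑ i, |x i| := by
  refine Real.sqrt_le_iff.mpr ⟨Finset.sum_nonneg fun i _ => abs_nonneg _, ?_⟩
  simpa using Finset.sum_sq_le_sq_sum_of_nonneg (s := Finset.univ) (f := fun i => |x i|)
    fun i _ => abs_nonneg _

lemma sum_abs_le_sqrt_mul_euclNorm {d : ℕ} (x : Fin d → ℝ) :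
    ∑ i, |x i| ≤ √d * euclNorm x := by
  rw [euclNorm, ← Real.sqrt_mul (Nat.cast_nonneg d)]
  refine Real.le_sqrt_of_sq_le ?_
  simpa using sq_sum_le_card_mul_sum_sq (s := Finset.univ) (f := fun i => |x i|)

lemma measurePreserving_eval_stdGaussian {d : ℕ} (i : Fin d) :
    MeasurePreserving (Function.eval i) (stdGaussian d) (gaussianReal 0 1) :=
  measurePreserving_eval (fun _ : Fin d => gaussianReal 0 1) i

lemma integrable_abs_gaussianReal : Integrable (fun x : ℝ => |x|) (gaussianReal 0 1) :=
  ((memLp_id_gaussianReal' 1 (by simp)).integrable le_rfl).abs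

lemma integrable_abs_eval_stdGaussian {d : ℕ} (i : Fin d) :
    Integrable (fun w : Fin d → ℝ => |w i|) (stdGaussian d) :=
  (measurePreserving_eval_stdGaussian i).integrable_comp_of_integrable
    integrable_abs_gaussianReal

lemma integral_comp_eval_stdGaussian {d : ℕ} (i : Fin d) {f : ℝ → ℝ} (hf : Continuous f) :
    ∫ w, f (w i) ∂stdGaussian d = ∫ x, f x ∂gaussianReal 0 1 := by
  rw [← (measurePreserving_eval_stdGaussian i).map_eq]
  exact (integral_map (measurable_pi_apply i).aemeasurable hf.aestronglyMeasurable).symm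

lemma integrable_euclNorm (d : ℕ) : Integrable euclNorm (stdGaussian d) := by
  refine Integrable.mono' (integrable_finsetSum Finset.univ
    fun i _ => integrable_abs_eval_stdGaussian i)
    continuous_euclNorm.aestronglyMeasurable (ae_of_all _ fun x => ?_)
  rw [Real.norm_of_nonneg (euclNorm_nonneg x)]
  exact euclNorm_le_sum_abs x

lemma gaussianAbsMean_pos : 0 < gaussianAbsMean := by
  refine lt_of_le_of_ne (integral_nonneg fun x => abs_nonneg x) fun h => ?_
  have h0 := (integral_eq_zero_iff_of_nonneg (fun x => abs_nonneg x)
    integrable_abs_gaussianReal).mp h.symm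
  have : NullSingletonClass (gaussianReal 0 1) := nullSingletonClass_gaussianReal one_ne_zero
  have h1 : ∀ᵐ x ∂gaussianReal 0 1, x ≠ 0 := by
    rw [ae_iff]
    simp
  obtain ⟨x, hx0, hx1⟩ := (h0.and h1).exists
  exact hx1 (abs_eq_zero.mp hx0)

lemma gaussianAbsMean_mul_sqrt_le_integral_euclNorm {d : ℕ} (hd : 1 ≤ d) :
    gaussianAbsMean * √d ≤ ∫ w, euclNorm w ∂stdGaussian d := by
  have h : ∫ w, ∑ i, |w i| ∂stdGaussian d ≤ ∫ w, √d * euclNorm w ∂stdGaussian d :=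
    integral_mono (integrable_finsetSum _ fun i _ => integrable_abs_eval_stdGaussian i)
      ((integrable_euclNorm d).const_mul _) sum_abs_le_sqrt_mul_euclNorm
  rw [integral_finsetSum _ fun i _ => integrable_abs_eval_stdGaussian i,
    integral_const_mul] at h
  simp_rw [integral_comp_eval_stdGaussian _ continuous_abs] at h
  have hd0 : (0 : ℝ) < √d := Real.sqrt_pos.mpr (by exact_mod_cast hd)
  have hs : √(d : ℝ) * √d = d := Real.mul_self_sqrt (Nat.cast_nonneg d)
  simp only [Finset.sum_const, Finset.card_univ, Fintype.card_fin, nsmul_eq_mul] at h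
  refine le_of_mul_le_mul_left ?_ hd0
  calc √d * (gaussianAbsMean * √d) = √d * √d * gaussianAbsMean := by ring
    _ = d * gaussianAbsMean := by rw [hs]
    _ ≤ _ := h

/-- The Euclidean norm of a standard Gaussian vector has a tail of order `exp (-c t)` relative to
its mean, uniformly in the dimension. -/
lemma exists_tail_bound_euclNorm :
    ∃ M > (0 : ℝ), ∃ δ > (0 : ℝ), ∀ d : ℕ, 1 ≤ d → ∀ t : ℝ, 1 ≤ t →
      stdGaussian d {w | t * (∫ w, euclNorm w ∂stdGaussian d) < euclNorm w}
        ≤ ENNReal.ofReal (M * Real.exp (-δ * t)) := by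
  obtain ⟨a, ha, hint⟩ := IsGaussian.exists_integrable_exp_sq (gaussianReal 0 1)
  have hκ := gaussianAbsMean_pos
  set M : ℝ := ∫ x, Real.exp (a * ‖x‖ ^ 2) ∂gaussianReal 0 1 with hM
  have hM0 : 0 ≤ M := integral_nonneg fun x => (Real.exp_pos _).le
  refine ⟨M + 1, by positivity, a * gaussianAbsMean ^ 2, by positivity, fun d hd t ht => ?_⟩
  have hd0 : (0 : ℝ) < d := by exact_mod_cast hd
  let f : (Fin d → ℝ) → ℝ := fun w => ∑ i, (d : ℝ)⁻¹ * Real.exp (a * ‖w i‖ ^ 2)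
  have hfi (i : Fin d) :
      Integrable (fun w : Fin d → ℝ => (d : ℝ)⁻¹ * Real.exp (a * ‖w i‖ ^ 2)) (stdGaussian d) :=
    ((measurePreserving_eval_stdGaussian i).integrable_comp_of_integrable hint).const_mul _
  have hf : Integrable f (stdGaussian d) := integrable_finsetSum _ fun i _ => hfi i
  have hfM : ∫ w, f w ∂stdGaussian d = M := by
    simp only [f]
    rw [integral_finsetSum _ fun i _ => hfi i]
    simp_rw [integral_const_mul]
    simp_rw [integral_comp_eval_stdGaussian (f := fun x => Real.exp (a * ‖x‖ ^ 2)) _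
      (by fun_prop), ← hM]
    simp [hd0.ne']
  have hfnn (w : Fin d → ℝ) : 0 ≤ f w := Finset.sum_nonneg fun i _ => by positivity
  have hjensen (w : Fin d → ℝ) : Real.exp (a * (euclNorm w ^ 2 / d)) ≤ f w := by
    have h := convexOn_exp.map_sum_le (t := Finset.univ) (w := fun _ : Fin d => (d : ℝ)⁻¹)
      (p := fun i => a * ‖w i‖ ^ 2) (fun i _ => by positivity) (by simp [hd0.ne'])
      (fun i _ => Set.mem_univ _)
    simp only [smul_eq_mul] at h
    refine le_trans (le_of_eq ?_) h
    congr 1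
    rw [sq_euclNorm, ← Finset.mul_sum, ← Finset.mul_sum]
    simp only [Real.norm_eq_abs, sq_abs]
    ring
  have hEW := gaussianAbsMean_mul_sqrt_le_integral_euclNorm hd
  set EW := ∫ w, euclNorm w ∂stdGaussian d
  set e : ℝ := Real.exp (a * gaussianAbsMean ^ 2 * t) with he
  have he0 : 0 < e := Real.exp_pos _
  have hsub : {w | t * EW < euclNorm w} ⊆ {w | e ≤ f w} := by
    intro w hw
    refine le_trans (Real.exp_le_exp.mpr ?_) (hjensen w)
    have h1 : t * (gaussianAbsMean * √d) ≤ euclNorm w :=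
      (mul_le_mul_of_nonneg_left hEW (by linarith)).trans (le_of_lt hw)
    have h2 : (t * (gaussianAbsMean * √d)) ^ 2 ≤ euclNorm w ^ 2 :=
      pow_le_pow_left₀ (by positivity) h1 2
    have h3 : t ^ 2 * gaussianAbsMean ^ 2 ≤ euclNorm w ^ 2 / d := by
      rw [le_div_iff₀ hd0]
      calc t ^ 2 * gaussianAbsMean ^ 2 * d = (t * (gaussianAbsMean * √d)) ^ 2 := by
            rw [mul_pow, mul_pow, Real.sq_sqrt hd0.le]; ring
        _ ≤ _ := h2
    have h4 : gaussianAbsMean ^ 2 * t ≤ t ^ 2 * gaussianAbsMean ^ 2 := by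
      nlinarith [mul_nonneg (sq_nonneg gaussianAbsMean) (by nlinarith : 0 ≤ t ^ 2 - t)]
    rw [mul_assoc]
    exact mul_le_mul_of_nonneg_left (h4.trans h3) ha.le
  have hmarkov := mul_meas_ge_le_integral_of_nonneg (ae_of_all _ hfnn) hf e
  rw [hfM] at hmarkov
  refine (measure_mono hsub).trans ?_
  rw [← ofReal_measureReal]
  refine ENNReal.ofReal_le_ofReal ?_
  rw [neg_mul, Real.exp_neg, ← he, ← div_eq_mul_inv, le_div_iff₀ he0]
  linarith

lemma measurePreserving_neg_stdGaussian (d : ℕ) :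
    MeasurePreserving (fun w : Fin d → ℝ => -w) (stdGaussian d) (stdGaussian d) := by
  have h : MeasurePreserving (fun x : ℝ => -x) (gaussianReal 0 1) (gaussianReal 0 1) :=
    ⟨measurable_neg, by simpa using gaussianReal_map_neg (μ := 0) (v := 1)⟩
  exact measurePreserving_pi _ _ fun _ => h

section NormBounds

variable {n : ℕ} {N : (Fin n → ℝ) → ℝ}

lemma nonneg_of_subadditive_of_abs_homogeneous (hadd : ∀ x y, N (x + y) ≤ N x + N y)
    (hsmul : ∀ (r : ℝ) (x), N (r • x) = |r| * N x) (x : Fin n → ℝ) : 0 ≤ N x := by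
  have h0 : N 0 = 0 := by simpa using hsmul 0 0
  have h1 := hadd x ((-1 : ℝ) • x)
  rw [hsmul] at h1
  simp [h0] at h1
  linarith

lemma abs_sub_le_of_subadditive (hadd : ∀ x y, N (x + y) ≤ N x + N y)
    (hsmul : ∀ (r : ℝ) (x), N (r • x) = |r| * N x) (x y : Fin n → ℝ) :
    |N (x + y) - N x| ≤ N y := by
  have h1 := hadd x y
  have h2 := hadd (x + y) ((-1 : ℝ) • y)
  rw [hsmul] at h2
  simp at h2
  rw [abs_le]
  constructor <;> linarith

lemma continuous_of_le_euclNorm (hadd : ∀ x y, N (x + y) ≤ N x + N y)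
    (hsmul : ∀ (r : ℝ) (x), N (r • x) = |r| * N x) (hle : ∀ x, N x ≤ euclNorm x) :
    Continuous N := by
  refine continuous_iff_continuousAt.mpr fun x => tendsto_iff_dist_tendsto_zero.mpr ?_
  have hlim : Filter.Tendsto (fun y => euclNorm (y - x)) (nhds x) (nhds 0) := by
    have h : Continuous fun y => euclNorm (y - x) :=
      continuous_euclNorm.comp (continuous_id.sub continuous_const)
    simpa [euclNorm] using h.tendsto x
  refine squeeze_zero (fun y => dist_nonneg) (fun y => ?_) hlim
  have h := abs_sub_le_of_subadditive hadd hsmul x (y - x)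
  rw [add_sub_cancel] at h
  exact h.trans (hle _)

end NormBounds

/-- Lifting concentration from a subspace `F` to the whole space. The subspace `F` of
dimension `m` and its orthogonal complement `F^⊥` are parametrized by Euclidean
isometric embeddings `ι₁ : ℝᵐ → ℝⁿ`, `ι₂ : ℝ^{n-m} → ℝⁿ` with orthogonal ranges, so
that `G = ι₁ Z + ι₂ W ~ N(0, Iₙ)` for independent standard Gaussians `Z, W`; the map
`S(x + y) = Tx + λ y` (`x ∈ F`, `y ∈ F^⊥`) satisfies `‖S G‖ = N(ι₁(TZ) + λ ι₂ W)`. -/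
theorem statement15 :
    ∀ C₀ > (0 : ℝ), ∀ c₀ > (0 : ℝ), ∃ C > (0 : ℝ), ∃ c > (0 : ℝ),
      ∀ n : ℕ, 3 ≤ n →
      ∀ N : (Fin n → ℝ) → ℝ,
        (∀ x y, N (x + y) ≤ N x + N y) →
        (∀ (r : ℝ) (x), N (r • x) = |r| * N x) →
        (∀ x, N x = 0 → x = 0) →
        (∀ x, N x ≤ euclNorm x) →
      ∀ m : ℕ, 1 ≤ m → 2 * m ≤ n →
      ∀ (ι₁ : (Fin m → ℝ) →ₗ[ℝ] (Fin n → ℝ))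
        (ι₂ : (Fin (n - m) → ℝ) →ₗ[ℝ] (Fin n → ℝ)),
        (∀ z, euclNorm (ι₁ z) = euclNorm z) →
        (∀ w, euclNorm (ι₂ w) = euclNorm w) →
        (∀ z w, dotProd (ι₁ z) (ι₂ w) = 0) →
      ∀ T : (Fin m → ℝ) ≃ₗ[ℝ] (Fin m → ℝ),
      ∀ ETZ EW lam ESG : ℝ,
        ETZ = (∫ z, N (ι₁ (T z)) ∂stdGaussian m) →
        EW = (∫ w, euclNorm w ∂stdGaussian (n - m)) →
        lam = ETZ / (EW * Real.log n) →
        ESG = (∫ p, N (ι₁ (T p.1) + lam • ι₂ p.2)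
                ∂((stdGaussian m).prod (stdGaussian (n - m)))) →
        (∀ ε > (0 : ℝ),
          stdGaussian m {z | ε * ETZ < |N (ι₁ (T z)) - ETZ|}
            ≤ ENNReal.ofReal (C₀ * Real.exp (-c₀ * ε * Real.log n))) →
        (ETZ ≤ ESG ∧ ESG ≤ (1 + 1 / Real.log n) * ETZ) ∧
        ∀ ε : ℝ, 0 < ε → ε < 1 →
          ((stdGaussian m).prod (stdGaussian (n - m)))
              {p | ε * ESG < |N (ι₁ (T p.1) + lam • ι₂ p.2) - ESG|}
            ≤ ENNReal.ofReal (C * Real.exp (-c * ε * Real.log n)) := by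
  intro C₀ hC₀ c₀ hc₀
  obtain ⟨M, hM, δ, hδ, htail⟩ := exists_tail_bound_euclNorm
  set c : ℝ := min (c₀ / 3) (δ / 3) with hc
  have hc0 : 0 < c := by positivity
  refine ⟨C₀ + M + Real.exp (3 * c), by positivity, c, hc0, ?_⟩
  intro n hn N hadd hsmul _ hle m hm hmn ι₁ ι₂ _ hι₂ _ T ETZ EW lam ESG hETZ hEW hlam hESG hconc
  have hk : 1 ≤ n - m := by omega
  have hL : 0 < Real.log n := Real.log_pos (by exact_mod_cast (by omega : 1 < n))
  have hEW0 : 0 < EW := by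
    rw [hEW]
    refine lt_of_lt_of_le ?_ (gaussianAbsMean_mul_sqrt_le_integral_euclNorm hk)
    exact mul_pos gaussianAbsMean_pos (Real.sqrt_pos.mpr (by exact_mod_cast hk))
  have hN0 := nonneg_of_subadditive_of_abs_homogeneous hadd hsmul
  have hETZ0 : 0 ≤ ETZ := hETZ ▸ integral_nonneg fun z => hN0 _
  have hlam0 : 0 ≤ lam := by rw [hlam]; positivity
  have hlamEW : lam * EW = ETZ / Real.log n := by rw [hlam]; field_simp
  have hNc := continuous_of_le_euclNorm hadd hsmul hle
  have hι₁c : Continuous ι₁ := ι₁.continuous_of_finiteDimensional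
  have hι₂c : Continuous ι₂ := ι₂.continuous_of_finiteDimensional
  have hTc : Continuous T := T.toLinearMap.continuous_of_finiteDimensional
  set μ := stdGaussian m
  set ν := stdGaussian (n - m)
  have hW (w : Fin (n - m) → ℝ) : N (lam • ι₂ w) ≤ lam * euclNorm w := by
    rw [hsmul, abs_of_nonneg hlam0, ← hι₂ w]
    exact mul_le_mul_of_nonneg_left (hle _) hlam0
  have hintZ : Integrable (fun z => N (ι₁ (T z))) μ := by
    let A : EuclideanSpace ℝ (Fin m) →L[ℝ] EuclideanSpace ℝ (Fin n) :=
      LinearMap.toContinuousLinearMap ((WithLp.linearEquiv 2 ℝ _).symm.toLinearMap ∘ₗ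
        (ι₁ ∘ₗ T.toLinearMap) ∘ₗ (WithLp.linearEquiv 2 ℝ _).toLinearMap)
    refine ((integrable_euclNorm m).const_mul ‖A‖).mono'
      (hNc.comp (hι₁c.comp hTc)).aestronglyMeasurable (ae_of_all _ fun z => ?_)
    rw [Real.norm_of_nonneg (hN0 _)]
    refine (hle _).trans ?_
    rw [euclNorm_eq_norm, euclNorm_eq_norm]
    exact A.le_opNorm (WithLp.toLp 2 z)
  have hintZp : Integrable (fun p : (Fin m → ℝ) × (Fin (n - m) → ℝ) => N (ι₁ (T p.1)))
      (μ.prod ν) := hintZ.comp_fst ν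
  have hintWp : Integrable
      (fun p : (Fin m → ℝ) × (Fin (n - m) → ℝ) => lam * euclNorm p.2) (μ.prod ν) :=
    ((integrable_euclNorm (n - m)).const_mul lam).comp_snd μ
  have hupper (p : (Fin m → ℝ) × (Fin (n - m) → ℝ)) :
      N (ι₁ (T p.1) + lam • ι₂ p.2) ≤ N (ι₁ (T p.1)) + lam * euclNorm p.2 :=
    (hadd _ _).trans (by linarith [hW p.2])
  have hintS : Integrable
      (fun p : (Fin m → ℝ) × (Fin (n - m) → ℝ) => N (ι₁ (T p.1) + lam • ι₂ p.2)) (μ.prod ν) := by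
    refine (hintZp.add hintWp).mono' (by fun_prop) (ae_of_all _ fun p => ?_)
    rw [Real.norm_of_nonneg (hN0 _)]
    exact hupper p
  have hZp : ∫ p, N (ι₁ (T p.1)) ∂μ.prod ν = ETZ := by
    rw [hETZ, integral_fun_fst (fun z => N (ι₁ (T z)))]; simp
  have hneg : ∫ p, N (ι₁ (T p.1) + lam • ι₂ (-p.2)) ∂μ.prod ν = ESG := by
    have hmp : MeasurePreserving (MeasurableEquiv.prodCongr (MeasurableEquiv.refl (Fin m → ℝ))
        (MeasurableEquiv.neg (Fin (n - m) → ℝ))) (μ.prod ν) (μ.prod ν) :=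
      (MeasurePreserving.id μ).prod (measurePreserving_neg_stdGaussian (n - m))
    rw [hESG]
    exact hmp.integral_comp' (fun p => N (ι₁ (T p.1) + lam • ι₂ p.2))
  have hintneg : Integrable
      (fun p : (Fin m → ℝ) × (Fin (n - m) → ℝ) => N (ι₁ (T p.1) + lam • ι₂ (-p.2)))
      (μ.prod ν) := by
    exact ((MeasurePreserving.id μ).prod
      (measurePreserving_neg_stdGaussian (n - m))).integrable_comp_of_integrable hintS
  have hlow : ETZ ≤ ESG := by
    have h : ∫ p, 2 * N (ι₁ (T p.1)) ∂μ.prod ν ≤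
        ∫ p, (N (ι₁ (T p.1) + lam • ι₂ p.2) + N (ι₁ (T p.1) + lam • ι₂ (-p.2))) ∂μ.prod ν := by
      refine integral_mono (hintZp.const_mul 2) (hintS.add hintneg) fun p => ?_
      have h1 := hadd (ι₁ (T p.1) + lam • ι₂ p.2) (ι₁ (T p.1) + lam • ι₂ (-p.2))
      have h2 : ι₁ (T p.1) + lam • ι₂ p.2 + (ι₁ (T p.1) + lam • ι₂ (-p.2))
          = (2 : ℝ) • ι₁ (T p.1) := by
        rw [map_neg]; module
      rw [h2, hsmul, abs_two] at h1
      exact h1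
    rw [integral_const_mul, integral_add hintS hintneg, hZp, hneg, ← hESG] at h
    linarith
  have hup : ESG ≤ ETZ + ETZ / Real.log n := by
    have h := integral_mono hintS (hintZp.add hintWp) hupper
    simp only [Pi.add_apply] at h
    rw [integral_add hintZp hintWp, hZp, ← hESG, integral_const_mul,
      integral_fun_snd (fun w => euclNorm w), ← hEW] at h
    simpa [hlamEW] using h
  refine ⟨⟨hlow, hup.trans_eq (by ring)⟩, fun ε hε _ => ?_⟩
  rcases le_or_gt (ε * Real.log n) 3 with hsmall | hlarge
  · refine prob_le_one.trans ?_
    rw [ENNReal.one_le_ofReal]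
    calc (1 : ℝ) ≤ Real.exp (3 * c + -c * ε * Real.log n) := by
          refine Real.one_le_exp ?_
          nlinarith [mul_le_mul_of_nonneg_left hsmall hc0.le]
      _ = Real.exp (3 * c) * Real.exp (-c * ε * Real.log n) := Real.exp_add _ _
      _ ≤ _ := mul_le_mul_of_nonneg_right (by linarith) (Real.exp_pos _).le
  · set t : ℝ := ε * Real.log n / 3 with ht
    have hETZL : ETZ / Real.log n ≤ ε / 3 * ETZ := by
      rw [div_le_iff₀ hL]
      nlinarith
    have hsub : {p : (Fin m → ℝ) × (Fin (n - m) → ℝ) |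
          ε * ESG < |N (ι₁ (T p.1) + lam • ι₂ p.2) - ESG|} ⊆
        ({z | ε / 3 * ETZ < |N (ι₁ (T z)) - ETZ|} ×ˢ Set.univ) ∪
          (Set.univ ×ˢ {w | t * EW < euclNorm w}) := by
      intro p hp
      by_contra hcon
      simp only [Set.mem_union, Set.mem_prod, Set.mem_ofPred_eq, Set.mem_univ, and_true,
        true_and, not_or, not_lt] at hcon
      obtain ⟨hz, hw⟩ := hcon
      have h1 : lam * euclNorm p.2 ≤ ε / 3 * ETZ := by
        calc lam * euclNorm p.2 ≤ lam * (t * EW) := mul_le_mul_of_nonneg_left hw hlam0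
          _ = t * (lam * EW) := by ring
          _ = ε / 3 * ETZ := by rw [hlamEW, ht]; field_simp
      have h2 := (abs_sub_le_of_subadditive hadd hsmul (ι₁ (T p.1)) (lam • ι₂ p.2)).trans (hW p.2)
      have h3 : ε * ETZ ≤ ε * ESG := mul_le_mul_of_nonneg_left hlow hε.le
      refine not_lt.mpr ?_ (Set.mem_ofPred_eq ▸ hp)
      rw [abs_le] at h2 hz ⊢
      constructor <;> linarith [h2.1, h2.2, hz.1, hz.2]
    refine (measure_mono hsub).trans ((measure_union_le _ _).trans ?_)
    rw [Measure.prod_prod, Measure.prod_prod, measure_univ, measure_univ, mul_one, one_mul]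
    have hbW := htail (n - m) hk t (by linarith)
    rw [← hEW] at hbW
    refine (add_le_add (hconc (ε / 3) (by positivity)) hbW).trans ?_
    rw [← ENNReal.ofReal_add (by positivity) (by positivity)]
    refine ENNReal.ofReal_le_ofReal ?_
    have hεL : 0 ≤ ε * Real.log n := by positivity
    have e1 : Real.exp (-c₀ * (ε / 3) * Real.log n) ≤ Real.exp (-c * ε * Real.log n) := by
      refine Real.exp_le_exp.mpr ?_
      nlinarith [mul_le_mul_of_nonneg_right (min_le_left (c₀ / 3) (δ / 3)) hεL]
    have e2 : Real.exp (-δ * t) ≤ Real.exp (-c * ε * Real.log n) := by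
      refine Real.exp_le_exp.mpr ?_
      nlinarith [mul_le_mul_of_nonneg_right (min_le_right (c₀ / 3) (δ / 3)) hεL]
    calc C₀ * Real.exp (-c₀ * (ε / 3) * Real.log n) + M * Real.exp (-δ * t)
        ≤ C₀ * Real.exp (-c * ε * Real.log n) + M * Real.exp (-c * ε * Real.log n) := by gcongr
      _ ≤ _ := by nlinarith [mul_pos (Real.exp_pos (3 * c)) (Real.exp_pos (-c * ε * Real.log n))]
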